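/- Let Λ be a finite-dimensional algebra over a field K. There exists an infinite semibrick in mod Λ if and only if there exist a torsion class T in mod Λ and infinitely many pairwise distinct torsion classes T1, T2, T3, … in mod Λ such that each Ti covers T. -/

import Mathlib

open Function DirectSum

namespace BrickPaper

variable (Λ : Type) [Ring Λ]

/-- `M` belongs to `mod Λ`, i.e. is a finitely generated module. -/
abbrev FG (M : ModuleCat.{0} Λ) : Prop := Module.Finite Λ M

/-- A class of modules closed under isomorphism. -/
def IsoClosed (C : Set (ModuleCat.{0} Λ)) : Prop :=
  ∀ ⦃M N : ModuleCat.{0} Λ⦄, Nonempty (M ≃ₗ[Λ] N) → M ∈ C → N ∈ C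

/-- A class of modules containing the zero modules. -/
def HasZeroObj (C : Set (ModuleCat.{0} Λ)) : Prop :=
  ∀ M : ModuleCat.{0} Λ, Subsingleton M → M ∈ C

/-- Closure under extensions: if `0 → A → M → B → 0` is exact with `A, B ∈ C` then `M ∈ C`. -/
def ExtClosed (C : Set (ModuleCat.{0} Λ)) : Prop :=
  ∀ ⦃A M B : ModuleCat.{0} Λ⦄ (f : A →ₗ[Λ] M) (g : M →ₗ[Λ] B),
    Function.Injective f → Function.Surjective g →
    LinearMap.range f = LinearMap.ker g → A ∈ C → B ∈ C → M ∈ C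

/-- Closure under quotients (images of surjections). -/
def QuotClosed (C : Set (ModuleCat.{0} Λ)) : Prop :=
  ∀ ⦃M N : ModuleCat.{0} Λ⦄ (g : M →ₗ[Λ] N), Function.Surjective g → M ∈ C → N ∈ C

/-- Closure under submodules (sources of injections). -/
def SubClosed (C : Set (ModuleCat.{0} Λ)) : Prop :=
  ∀ ⦃M N : ModuleCat.{0} Λ⦄ (f : M →ₗ[Λ] N), Function.Injective f → N ∈ C → M ∈ C

/-- Closure under kernels of morphisms between members. -/
def KerClosed (C : Set (ModuleCat.{0} Λ)) : Prop :=
  ∀ ⦃M N : ModuleCat.{0} Λ⦄ (f : M →ₗ[Λ] N), M ∈ C → N ∈ C →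
    ModuleCat.of Λ ↥(LinearMap.ker f) ∈ C

/-- Closure under cokernels of morphisms between members. -/
def CokerClosed (C : Set (ModuleCat.{0} Λ)) : Prop :=
  ∀ ⦃M N : ModuleCat.{0} Λ⦄ (f : M →ₗ[Λ] N), M ∈ C → N ∈ C →
    ModuleCat.of Λ ((N : Type) ⧸ LinearMap.range f) ∈ C

/-- A wide subcategory of `mod Λ`: a class of finitely generated modules, closed under
isomorphisms, containing `0`, and closed under kernels, cokernels and extensions. -/
def IsWide (C : Set (ModuleCat.{0} Λ)) : Prop :=
  (∀ M ∈ C, FG Λ M) ∧ IsoClosed Λ C ∧ HasZeroObj Λ C ∧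
    KerClosed Λ C ∧ CokerClosed Λ C ∧ ExtClosed Λ C

/-- A wide subcategory of the big module category `Mod Λ` (no finiteness condition). -/
def IsWideBig (C : Set (ModuleCat.{0} Λ)) : Prop :=
  IsoClosed Λ C ∧ HasZeroObj Λ C ∧ KerClosed Λ C ∧ CokerClosed Λ C ∧ ExtClosed Λ C

/-- A torsion class in `mod Λ`: closed under quotients and extensions. -/
def IsTorsionClass (C : Set (ModuleCat.{0} Λ)) : Prop :=
  (∀ M ∈ C, FG Λ M) ∧ IsoClosed Λ C ∧ HasZeroObj Λ C ∧ QuotClosed Λ C ∧ ExtClosed Λ C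

/-- A torsion-free class in `mod Λ`: closed under submodules and extensions. -/
def IsTorsionFreeClass (C : Set (ModuleCat.{0} Λ)) : Prop :=
  (∀ M ∈ C, FG Λ M) ∧ IsoClosed Λ C ∧ HasZeroObj Λ C ∧ SubClosed Λ C ∧ ExtClosed Λ C

/-- The smallest torsion class containing `X`. -/
def torsClosure (X : Set (ModuleCat.{0} Λ)) : Set (ModuleCat.{0} Λ) :=
  ⋂₀ {C | IsTorsionClass Λ C ∧ X ⊆ C}

/-- The smallest torsion-free class containing `X`. -/
def torfClosure (X : Set (ModuleCat.{0} Λ)) : Set (ModuleCat.{0} Λ) :=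
  ⋂₀ {C | IsTorsionFreeClass Λ C ∧ X ⊆ C}

/-- A widely generated torsion class. -/
def IsWidelyGenTors (T : Set (ModuleCat.{0} Λ)) : Prop :=
  IsTorsionClass Λ T ∧ ∃ W, IsWide Λ W ∧ T = torsClosure Λ W

/-- A widely generated torsion-free class. -/
def IsWidelyGenTorf (F : Set (ModuleCat.{0} Λ)) : Prop :=
  IsTorsionFreeClass Λ F ∧ ∃ W, IsWide Λ W ∧ F = torfClosure Λ W

/-- A finitely generated torsion class: generated by a single module of `mod Λ`. -/
def IsFinGenTors (T : Set (ModuleCat.{0} Λ)) : Prop :=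
  IsTorsionClass Λ T ∧ ∃ M : ModuleCat.{0} Λ, FG Λ M ∧ T = torsClosure Λ {M}

/-- `T' ` covers `T` in the poset of torsion classes. -/
def TorsCovers (T' T : Set (ModuleCat.{0} Λ)) : Prop :=
  IsTorsionClass Λ T' ∧ T ⊂ T' ∧
    ∀ T'', IsTorsionClass Λ T'' → T ⊂ T'' → T'' ⊆ T' → T'' = T'

/-- `F'` covers `F` in the poset of torsion-free classes. -/
def TorfCovers (F' F : Set (ModuleCat.{0} Λ)) : Prop :=
  IsTorsionFreeClass Λ F' ∧ F ⊂ F' ∧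
    ∀ F'', IsTorsionFreeClass Λ F'' → F ⊂ F'' → F'' ⊆ F' → F'' = F'

/-- A brick: a finitely generated module whose endomorphism ring is a division ring. -/
def IsBrick (M : ModuleCat.{0} Λ) : Prop :=
  FG Λ M ∧ Nontrivial M ∧ ∀ f : M →ₗ[Λ] M, f ≠ 0 → Function.Bijective f

/-- A semibrick, regarded as an isomorphism-closed class of bricks (i.e. a set of
isomorphism classes of bricks) which are pairwise Hom-orthogonal. -/
def IsSemibrick (S : Set (ModuleCat.{0} Λ)) : Prop :=
  (∀ M ∈ S, IsBrick Λ M) ∧ IsoClosed Λ S ∧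
    ∀ M ∈ S, ∀ N ∈ S, IsEmpty (M ≃ₗ[Λ] N) → ∀ f : M →ₗ[Λ] N, f = 0

/-- A monobrick, regarded as an isomorphism-closed class of bricks (i.e. a set of
isomorphism classes of bricks) such that every morphism between members is zero or injective. -/
def IsMonobrick (S : Set (ModuleCat.{0} Λ)) : Prop :=
  (∀ M ∈ S, IsBrick Λ M) ∧ IsoClosed Λ S ∧
    ∀ M ∈ S, ∀ N ∈ S, ∀ f : M →ₗ[Λ] N, f = 0 ∨ Function.Injective f

/-- `N` is a cofinal extension of the monobrick `M`. -/
def IsCofinalExtension (M N : Set (ModuleCat.{0} Λ)) : Prop :=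
  IsMonobrick Λ N ∧ M ⊆ N ∧
    ∀ X ∈ N, ∃ Y ∈ M, ∃ f : X →ₗ[Λ] Y, Function.Injective f

/-- A cofinally closed monobrick: a monobrick with no proper cofinal extension. -/
def IsCofinallyClosed (M : Set (ModuleCat.{0} Λ)) : Prop :=
  IsMonobrick Λ M ∧ ∀ N, IsCofinalExtension Λ M N → N = M

/-- `S` contains only finitely many modules up to isomorphism. -/
def FiniteUpToIso (S : Set (ModuleCat.{0} Λ)) : Prop :=
  ∃ B : Set (ModuleCat.{0} Λ), B.Finite ∧ ∀ M ∈ S, ∃ N ∈ B, Nonempty (M ≃ₗ[Λ] N)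

/-- `Λ` is brick-finite: there are only finitely many bricks up to isomorphism. -/
def BrickFinite : Prop := FiniteUpToIso Λ {M | IsBrick Λ M}

/-- Right Hom-perpendicular class `T^⊥` inside `mod Λ`. -/
def rPerp (T : Set (ModuleCat.{0} Λ)) : Set (ModuleCat.{0} Λ) :=
  {M | FG Λ M ∧ ∀ X ∈ T, ∀ f : X →ₗ[Λ] M, f = 0}

/-- Left Hom-perpendicular class `^⊥F` inside `mod Λ`. -/
def lPerp (F : Set (ModuleCat.{0} Λ)) : Set (ModuleCat.{0} Λ) :=
  {M | FG Λ M ∧ ∀ Y ∈ F, ∀ f : M →ₗ[Λ] Y, f = 0}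

/-- A minimal extending module for a torsion class `T`. -/
def IsMinExt (T : Set (ModuleCat.{0} Λ)) (M : ModuleCat.{0} Λ) : Prop :=
  FG Λ M ∧ Nontrivial M ∧
    (∀ S : Submodule Λ M, S ≠ ⊥ → ModuleCat.of Λ ((M : Type) ⧸ S) ∈ T) ∧
    (∀ (X T' : ModuleCat.{0} Λ) (f : M →ₗ[Λ] X) (g : X →ₗ[Λ] T'),
      Function.Injective f → Function.Surjective g →
      LinearMap.range f = LinearMap.ker g → T' ∈ T →
      (¬ ∃ r : X →ₗ[Λ] M, r ∘ₗ f = LinearMap.id) → X ∈ T) ∧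
    (∀ X ∈ T, ∀ f : X →ₗ[Λ] M, f = 0)

/-- A minimal co-extending module for a torsion-free class `F`. -/
def IsMinCoext (F : Set (ModuleCat.{0} Λ)) (M : ModuleCat.{0} Λ) : Prop :=
  FG Λ M ∧ Nontrivial M ∧
    (∀ S : Submodule Λ M, S ≠ ⊤ → ModuleCat.of Λ ↥S ∈ F) ∧
    (∀ (X F' : ModuleCat.{0} Λ) (f : F' →ₗ[Λ] X) (g : X →ₗ[Λ] M),
      Function.Injective f → Function.Surjective g →
      LinearMap.range f = LinearMap.ker g → F' ∈ F →
      (¬ ∃ s : M →ₗ[Λ] X, g ∘ₗ s = LinearMap.id) → X ∈ F) ∧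
    (∀ Y ∈ F, ∀ f : M →ₗ[Λ] Y, f = 0)

/-- The set (of representatives of isomorphism classes) of minimal extending modules. -/
def ME (T : Set (ModuleCat.{0} Λ)) : Set (ModuleCat.{0} Λ) := {M | IsMinExt Λ T M}

/-- The set (of representatives of isomorphism classes) of minimal co-extending modules. -/
def MCE (F : Set (ModuleCat.{0} Λ)) : Set (ModuleCat.{0} Λ) := {M | IsMinCoext Λ F M}

/-- `M` admits a finite filtration with subquotients isomorphic to members of `B`. -/
def FiltMem (B : Set (ModuleCat.{0} Λ)) (M : ModuleCat.{0} Λ) : Prop :=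
  ∃ (n : ℕ) (c : Fin (n + 1) → Submodule Λ M), Monotone c ∧ c 0 = ⊥ ∧ c (Fin.last n) = ⊤ ∧
    ∀ i : Fin n, ∃ N ∈ B,
      Nonempty ((↥(c i.succ) ⧸ Submodule.comap (c i.succ).subtype (c i.castSucc)) ≃ₗ[Λ] N)

/-- `Filt B`. -/
def filtClosure (B : Set (ModuleCat.{0} Λ)) : Set (ModuleCat.{0} Λ) :=
  {M | FiltMem Λ B M}

/-- The simple objects of a subcategory `C`, i.e. nonzero members with no proper nonzero
subobject belonging to `C`. -/
def simOf (C : Set (ModuleCat.{0} Λ)) : Set (ModuleCat.{0} Λ) :=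
  {M | M ∈ C ∧ Nontrivial M ∧
    ∀ (X : ModuleCat.{0} Λ) (f : X →ₗ[Λ] M), X ∈ C → Function.Injective f →
      LinearMap.range f = ⊥ ∨ LinearMap.range f = ⊤}

/-- The subcategory `α(T) = {X ∈ T : for all g : Y → X with Y ∈ T, ker g ∈ T}`. -/
def alphaOf (T : Set (ModuleCat.{0} Λ)) : Set (ModuleCat.{0} Λ) :=
  {X | X ∈ T ∧ ∀ (Y : ModuleCat.{0} Λ) (g : Y →ₗ[Λ] X), Y ∈ T →
    ModuleCat.of Λ ↥(LinearMap.ker g) ∈ T}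

/-- Covariantly finite subcategory of `mod Λ`. -/
def CovariantlyFinite (B : Set (ModuleCat.{0} Λ)) : Prop :=
  ∀ M : ModuleCat.{0} Λ, FG Λ M → ∃ N ∈ B, ∃ f : M →ₗ[Λ] N,
    ∀ N' ∈ B, ∀ g : M →ₗ[Λ] N', ∃ h : N →ₗ[Λ] N', h ∘ₗ f = g

/-- Contravariantly finite subcategory of `mod Λ`. -/
def ContravariantlyFinite (B : Set (ModuleCat.{0} Λ)) : Prop :=
  ∀ M : ModuleCat.{0} Λ, FG Λ M → ∃ N ∈ B, ∃ f : N →ₗ[Λ] M,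
    ∀ N' ∈ B, ∀ g : N' →ₗ[Λ] M, ∃ h : N' →ₗ[Λ] N, f ∘ₗ h = g

/-- Functorially finite subcategory of `mod Λ`. -/
def FunctoriallyFinite (B : Set (ModuleCat.{0} Λ)) : Prop :=
  CovariantlyFinite Λ B ∧ ContravariantlyFinite Λ B

/-- Closure under (set-indexed) coproducts. -/
def CoprodClosed (C : Set (ModuleCat.{0} Λ)) : Prop :=
  ∀ (ι : Type) (M : ι → ModuleCat.{0} Λ), (∀ i, M i ∈ C) →
    ModuleCat.of Λ (⨁ i, (M i : Type)) ∈ C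

/-- Closure under (set-indexed) products. -/
def ProdClosed (C : Set (ModuleCat.{0} Λ)) : Prop :=
  ∀ (ι : Type) (M : ι → ModuleCat.{0} Λ), (∀ i, M i ∈ C) →
    ModuleCat.of Λ ((i : ι) → (M i : Type)) ∈ C

/-! Lattice-theoretic notions in the complete lattice of torsion classes. -/

/-- The join of a set of torsion classes. -/
def torsJoin (X : Set (Set (ModuleCat.{0} Λ))) : Set (ModuleCat.{0} Λ) :=
  torsClosure Λ (⋃₀ X)

/-- The meet of a set of torsion classes (inside the lattice of torsion classes,
whose top element is `mod Λ`). -/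
def torsMeet (X : Set (Set (ModuleCat.{0} Λ))) : Set (ModuleCat.{0} Λ) :=
  {M | FG Λ M} ∩ ⋂₀ X

/-- A completely join-irreducible torsion class. -/
def CompletelyJoinIrred (J : Set (ModuleCat.{0} Λ)) : Prop :=
  IsTorsionClass Λ J ∧
    ∀ X : Set (Set (ModuleCat.{0} Λ)), (∀ a ∈ X, IsTorsionClass Λ a) →
      torsJoin Λ X = J → J ∈ X

/-- `J_* = ⋁ {x : x < J}`. -/
def jstar (J : Set (ModuleCat.{0} Λ)) : Set (ModuleCat.{0} Λ) :=
  torsJoin Λ {C | IsTorsionClass Λ C ∧ C ⊂ J}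

/-- `k = κ(J) = max {x : J ∧ x = J_*}`. -/
def IsKappa (J k : Set (ModuleCat.{0} Λ)) : Prop :=
  IsTorsionClass Λ k ∧ J ∩ k = jstar Λ J ∧
    ∀ C, IsTorsionClass Λ C → J ∩ C = jstar Λ J → C ⊆ k

/-- `A` is a join representation of the torsion class `T`. -/
def IsJoinRep (T : Set (ModuleCat.{0} Λ)) (A : Set (Set (ModuleCat.{0} Λ))) : Prop :=
  (∀ a ∈ A, IsTorsionClass Λ a) ∧ torsJoin Λ A = T

/-- `A` refines `B`. -/
def Refines (A B : Set (Set (ModuleCat.{0} Λ))) : Prop :=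
  ∀ a ∈ A, ∃ b ∈ B, a ⊆ b

/-- `A` is the canonical join representation of `T`. -/
def IsCJR (T : Set (ModuleCat.{0} Λ)) (A : Set (Set (ModuleCat.{0} Λ))) : Prop :=
  IsJoinRep Λ T A ∧ (∀ B, IsJoinRep Λ T B → Refines Λ A B) ∧
    ∀ a ∈ A, ∀ b ∈ A, a ⊆ b → a = b

/-- `Kb = κ̄(T) = ⋀ {κ(j) : j ∈ CJR(T)}`, the extended kappa map. -/
def IsKappaBar (T Kb : Set (ModuleCat.{0} Λ)) : Prop :=
  ∃ A, IsCJR Λ T A ∧ (∀ j ∈ A, CompletelyJoinIrred Λ j) ∧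
    (∀ j ∈ A, ∃ k, IsKappa Λ j k) ∧
    Kb = torsMeet Λ {k | ∃ j ∈ A, IsKappa Λ j k}

/-- The kappa order: `a ≤_κ b` iff `a ≤ b` and `κ̄(a) ≥ κ̄(b)`. -/
def KappaLE (a b : Set (ModuleCat.{0} Λ)) : Prop :=
  a ⊆ b ∧ ∀ Ka Kb, IsKappaBar Λ a Ka → IsKappaBar Λ b Kb → Kb ⊆ Ka

section Covers

variable {Λ}

theorem isTorsionClass_FG : IsTorsionClass Λ {M | FG Λ M} := by
  refine ⟨fun _ h => h, ?_, ?_, ?_, ?_⟩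
  · rintro M N ⟨e⟩ (h : Module.Finite Λ M)
    exact Module.Finite.equiv e
  · intro M h
    exact (inferInstance : Module.Finite Λ M)
  · intro M N g hg (h : Module.Finite Λ M)
    exact Module.Finite.of_surjective g hg
  · intro A M B f g _ hg hfg (hA : Module.Finite Λ A) (hB : Module.Finite Λ B)
    exact Module.Finite.of_exact (LinearMap.exact_iff.2 hfg.symm) hg

theorem isTorsionClass_sInter {X : Set (Set (ModuleCat.{0} Λ))} (hne : X.Nonempty)
    (hX : ∀ C ∈ X, IsTorsionClass Λ C) : IsTorsionClass Λ (⋂₀ X) := by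
  obtain ⟨C₀, hC₀⟩ := hne
  refine ⟨fun M hM => (hX C₀ hC₀).1 M (hM C₀ hC₀), ?_, ?_, ?_, ?_⟩
  · exact fun M N e hM C hC => (hX C hC).2.1 e (hM C hC)
  · exact fun M h C hC => (hX C hC).2.2.1 M h
  · exact fun M N g hg hM C hC => (hX C hC).2.2.2.1 g hg (hM C hC)
  · exact fun A M B f g hf hg hfg hA hB C hC =>
      (hX C hC).2.2.2.2 f g hf hg hfg (hA C hC) (hB C hC)

theorem isTorsionClass_torsClosure {X : Set (ModuleCat.{0} Λ)} (hX : ∀ M ∈ X, FG Λ M) :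
    IsTorsionClass Λ (torsClosure Λ X) :=
  isTorsionClass_sInter ⟨_, isTorsionClass_FG, hX⟩ fun _ h => h.1

theorem subset_torsClosure (X : Set (ModuleCat.{0} Λ)) : X ⊆ torsClosure Λ X :=
  Set.subset_sInter fun _ h => h.2

theorem torsClosure_subset {X C : Set (ModuleCat.{0} Λ)} (hC : IsTorsionClass Λ C)
    (h : X ⊆ C) : torsClosure Λ X ⊆ C :=
  Set.sInter_subset_of_mem ⟨hC, h⟩

theorem isTorsionClass_lPerp (F : Set (ModuleCat.{0} Λ)) : IsTorsionClass Λ (lPerp Λ F) := by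
  have hFG := isTorsionClass_FG (Λ := Λ)
  refine ⟨fun _ h => h.1, ?_, ?_, ?_, ?_⟩
  · rintro M N ⟨e⟩ hM
    refine ⟨hFG.2.1 ⟨e⟩ hM.1, fun Y hY f => ?_⟩
    have := hM.2 Y hY (f ∘ₗ e.toLinearMap)
    ext x
    simpa using LinearMap.congr_fun this (e.symm x)
  · intro M h
    exact ⟨hFG.2.2.1 M h, fun Y _ f => LinearMap.ext fun x => by simp [Subsingleton.elim x 0]⟩
  · intro M N g hg hM
    refine ⟨hFG.2.2.2.1 g hg hM.1, fun Y hY f => ?_⟩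
    have := hM.2 Y hY (f ∘ₗ g)
    ext x
    obtain ⟨m, rfl⟩ := hg x
    exact LinearMap.congr_fun this m
  · intro A M B f g hf hg hfg hA hB
    refine ⟨hFG.2.2.2.2 f g hf hg hfg hA.1 hB.1, fun Y hY h => ?_⟩
    have hker : LinearMap.ker g ≤ LinearMap.ker h := by
      rw [← hfg, LinearMap.range_le_ker_iff]
      exact hA.2 Y hY _
    let e := g.quotKerEquivOfSurjective hg
    have h0 := hB.2 Y hY ((LinearMap.ker g).liftQ h hker ∘ₗ e.symm.toLinearMap)
    ext x
    have hx := LinearMap.congr_fun h0 (e ((LinearMap.ker g).mkQ x))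
    rw [LinearMap.comp_apply, LinearEquiv.coe_coe, LinearEquiv.symm_apply_apply] at hx
    simpa using hx

variable (Λ) in
/-- `B` lies outside `T`, but each of its proper quotients lies in `T`. -/
def IsMinimalOutside (T : Set (ModuleCat.{0} Λ)) (B : ModuleCat.{0} Λ) : Prop :=
  FG Λ B ∧ B ∉ T ∧ ∀ S : Submodule Λ B, S ≠ ⊥ → ModuleCat.of Λ ((B : Type) ⧸ S) ∈ T

theorem IsTorsionClass.range_mem {U : Set (ModuleCat.{0} Λ)} (hU : IsTorsionClass Λ U)
    {X Y : ModuleCat.{0} Λ} (hX : X ∈ U) (f : X →ₗ[Λ] Y) :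
    ModuleCat.of Λ (LinearMap.range f) ∈ U :=
  hU.2.2.2.1 (N := ModuleCat.of Λ (LinearMap.range f)) f.rangeRestrict
    f.surjective_rangeRestrict hX

namespace IsMinimalOutside

variable {T : Set (ModuleCat.{0} Λ)} {B : ModuleCat.{0} Λ}

theorem mem_of_ne_zero (hB : IsMinimalOutside Λ T B) {U : Set (ModuleCat.{0} Λ)}
    (hU : IsTorsionClass Λ U) (hTU : T ⊆ U) {X : ModuleCat.{0} Λ} (hX : X ∈ U)
    {f : X →ₗ[Λ] B} (hf : f ≠ 0) : B ∈ U := by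
  refine hU.2.2.2.2 (A := ModuleCat.of Λ (LinearMap.range f))
    (B := ModuleCat.of Λ ((B : Type) ⧸ LinearMap.range f))
    (LinearMap.range f).subtype (LinearMap.range f).mkQ
    (Submodule.subtype_injective _) (Submodule.mkQ_surjective _) ?_ (hU.range_mem hX f)
    (hTU (hB.2.2 _ fun h => hf (LinearMap.range_eq_bot.1 h)))
  rw [Submodule.range_subtype, Submodule.ker_mkQ]

theorem eq_zero_of_mem (hB : IsMinimalOutside Λ T B) (hT : IsTorsionClass Λ T)
    {X : ModuleCat.{0} Λ} (hX : X ∈ T) (f : X →ₗ[Λ] B) : f = 0 := by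
  by_contra hf
  exact hB.2.1 (hB.mem_of_ne_zero hT subset_rfl hX hf)

theorem injective_of_ne_zero (hT : IsTorsionClass Λ T) (hB : IsMinimalOutside Λ T B)
    {B' : ModuleCat.{0} Λ} (hB' : IsMinimalOutside Λ T B') {f : B →ₗ[Λ] B'} (hf : f ≠ 0) :
    Function.Injective f := by
  rw [← LinearMap.ker_eq_bot]
  by_contra hker
  have h0 := hB'.eq_zero_of_mem hT (hB.2.2 _ hker) ((LinearMap.ker f).liftQ f le_rfl)
  apply hf
  rw [← (LinearMap.ker f).liftQ_mkQ f le_rfl]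
  ext x
  exact LinearMap.congr_fun h0 ((LinearMap.ker f).mkQ x)

theorem isBrick [IsArtinianRing Λ] (hT : IsTorsionClass Λ T) (hB : IsMinimalOutside Λ T B) :
    IsBrick Λ B := by
  have : Module.Finite Λ B := hB.1
  refine ⟨hB.1, ?_, fun f hf => ?_⟩
  · by_contra h
    exact hB.2.1 (hT.2.2.1 B (not_nontrivial_iff_subsingleton.1 h))
  · exact IsArtinian.bijective_of_injective_endomorphism f (hB.injective_of_ne_zero hT hB hf)

end IsMinimalOutside

theorem exists_isMinimalOutside [IsNoetherianRing Λ] {T U : Set (ModuleCat.{0} Λ)}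
    (hU : IsTorsionClass Λ U) {M : ModuleCat.{0} Λ} (hMU : M ∈ U) (hT : IsTorsionClass Λ T)
    (hMT : M ∉ T) : ∃ B ∈ U, IsMinimalOutside Λ T B := by
  have : Module.Finite Λ M := hU.1 M hMU
  have hne : {N : Submodule Λ M | ModuleCat.of Λ ((M : Type) ⧸ N) ∉ T}.Nonempty :=
    ⟨⊥, fun h => hMT (hT.2.1 ⟨Submodule.quotEquivOfEqBot _ rfl⟩ h)⟩
  obtain ⟨N, hN, hmax⟩ :=
    (wellFounded_gt : WellFounded ((· > ·) : Submodule Λ M → Submodule Λ M → Prop)).has_min _ hne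
  have hNU : ModuleCat.of Λ ((M : Type) ⧸ N) ∈ U :=
    hU.2.2.2.1 (N := ModuleCat.of Λ ((M : Type) ⧸ N)) N.mkQ N.mkQ_surjective hMU
  refine ⟨_, hNU, hU.1 _ hNU, hN, fun S hS => ?_⟩
  have hlt : N < S.comap N.mkQ := by
    refine lt_of_le_of_ne (Submodule.le_comap_mkQ N S) fun h => hS ?_
    rw [← Submodule.map_comap_eq_of_surjective N.mkQ_surjective S, ← h, Submodule.mkQ_map_self]
  have hmem : ModuleCat.of Λ ((M : Type) ⧸ S.comap N.mkQ) ∈ T := by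
    by_contra h
    exact hmax _ h hlt
  refine hT.2.2.2.1 (N := ModuleCat.of Λ (((M : Type) ⧸ N) ⧸ S))
    ((S.comap N.mkQ).mapQ S N.mkQ le_rfl) ?_ hmem
  intro y
  obtain ⟨y, rfl⟩ := S.mkQ_surjective y
  obtain ⟨x, rfl⟩ := N.mkQ_surjective y
  exact ⟨(S.comap N.mkQ).mkQ x, rfl⟩

theorem TorsCovers.eq_of_mem {T T₁ T₂ : Set (ModuleCat.{0} Λ)} (h₁ : TorsCovers Λ T₁ T)
    (h₂ : TorsCovers Λ T₂ T) {B : ModuleCat.{0} Λ} (hB : B ∉ T) (hB₁ : B ∈ T₁)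
    (hB₂ : B ∈ T₂) : T₁ = T₂ := by
  have htors : IsTorsionClass Λ (T₁ ∩ T₂) := by
    rw [← Set.sInter_pair]
    refine isTorsionClass_sInter ⟨T₁, by simp⟩ ?_
    rintro C (rfl | rfl)
    exacts [h₁.1, h₂.1]
  have hlt : T ⊂ T₁ ∩ T₂ :=
    ⟨Set.subset_inter h₁.2.1.1 h₂.2.1.1, fun h => hB (h ⟨hB₁, hB₂⟩)⟩
  exact (h₁.2.2 _ htors hlt Set.inter_subset_left).symm.trans
    (h₂.2.2 _ htors hlt Set.inter_subset_right)

theorem exists_infinite_semibrick_of_infinite_covers [IsArtinianRing Λ]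
    {T : Set (ModuleCat.{0} Λ)} (hT : IsTorsionClass Λ T)
    (hinf : {T' | TorsCovers Λ T' T}.Infinite) :
    ∃ S, IsSemibrick Λ S ∧ ¬ FiniteUpToIso Λ S := by
  have hex : ∀ T', TorsCovers Λ T' T → ∃ B ∈ T', IsMinimalOutside Λ T B := by
    intro T' h
    obtain ⟨M, hM, hMT⟩ := Set.exists_of_ssubset h.2.1
    exact exists_isMinimalOutside h.1 hM hT hMT
  choose b hbmem hbmin using hex
  refine ⟨{M | ∃ T' h, Nonempty (b T' h ≃ₗ[Λ] M)}, ⟨?_, ?_, ?_⟩, ?_⟩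
  · rintro M ⟨T', h, ⟨e⟩⟩
    obtain ⟨hfin, hnt, hend⟩ := (hbmin T' h).isBrick hT
    refine ⟨isTorsionClass_FG.2.1 ⟨e⟩ hfin, e.symm.toEquiv.nontrivial, fun f hf => ?_⟩
    have := hend (e.symm.toLinearMap ∘ₗ f ∘ₗ e.toLinearMap) fun h0 => hf <| by
      ext x
      simpa using LinearMap.congr_fun h0 (e.symm x)
    have h2 : Function.Bijective (e.symm ∘ f ∘ e) := this
    rwa [Function.Bijective.of_comp_iff' e.symm.bijective,
      Function.Bijective.of_comp_iff _ e.bijective] at h2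
  · rintro M N ⟨e'⟩ ⟨T', h, ⟨e⟩⟩
    exact ⟨T', h, ⟨e.trans e'⟩⟩
  · rintro M ⟨T₁, h₁, ⟨e₁⟩⟩ N ⟨T₂, h₂, ⟨e₂⟩⟩ hMN f
    by_contra hf
    have hg : e₂.symm.toLinearMap ∘ₗ f ∘ₗ e₁.toLinearMap ≠ 0 := fun h0 => hf <| by
      ext x
      simpa using LinearMap.congr_fun h0 (e₁.symm x)
    have hmem := (hbmin T₂ h₂).mem_of_ne_zero h₁.1 h₁.2.1.1 (hbmem T₁ h₁) hg
    obtain rfl := h₁.eq_of_mem h₂ (hbmin T₂ h₂).2.1 hmem (hbmem T₂ h₂)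
    exact hMN.false (e₁.symm.trans e₂)
  · rintro ⟨F, hF, hcov⟩
    have hrep : ∀ T' : {T' | TorsCovers Λ T' T}, ∃ N : F, Nonempty (b T'.1 T'.2 ≃ₗ[Λ] N.1) := by
      rintro ⟨T', h⟩
      obtain ⟨N, hN, e⟩ := hcov (b T' h) ⟨T', h, ⟨LinearEquiv.refl _ _⟩⟩
      exact ⟨⟨N, hN⟩, e⟩
    choose φ hφ using hrep
    have : Finite F := hF
    refine hinf (Finite.of_injective φ ?_)
    rintro ⟨T₁, h₁⟩ ⟨T₂, h₂⟩ h
    obtain ⟨e₁⟩ := hφ ⟨T₁, h₁⟩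
    obtain ⟨e₂⟩ := hφ ⟨T₂, h₂⟩
    rw [h] at e₁
    exact Subtype.ext (h₁.eq_of_mem h₂ (hbmin T₂ h₂).2.1
      (h₁.1.2.1 ⟨e₁.trans e₂.symm⟩ (hbmem T₁ h₁)) (hbmem T₂ h₂))

theorem IsBrick.notMem_lPerp {B : ModuleCat.{0} Λ} (hB : IsBrick Λ B)
    {F : Set (ModuleCat.{0} Λ)} (hBF : B ∈ F) : B ∉ lPerp Λ F := by
  intro h
  have := hB.2.1
  obtain ⟨x, hx⟩ := exists_ne (0 : B)
  exact hx (LinearMap.congr_fun (h.2 B hBF LinearMap.id) x)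

namespace IsSemibrick

variable {S : Set (ModuleCat.{0} Λ)} {B B' : ModuleCat.{0} Λ}

theorem isMinimalOutside (hS : IsSemibrick Λ S) (hB : B ∈ S) :
    IsMinimalOutside Λ (lPerp Λ S) B := by
  have hbrick := hS.1 B hB
  have hfin : Module.Finite Λ B := hbrick.1
  refine ⟨hbrick.1, hbrick.notMem_lPerp hB, fun N hN => ⟨?_, fun Y hY f => ?_⟩⟩
  · exact Module.Finite.of_surjective N.mkQ N.mkQ_surjective
  by_contra hf
  have hg : (f : (B ⧸ N) →ₗ[Λ] Y) ∘ₗ N.mkQ ≠ 0 := fun h0 => hf <| by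
    apply LinearMap.ext
    intro x
    obtain ⟨x, rfl⟩ := N.mkQ_surjective x
    exact LinearMap.congr_fun h0 x
  by_cases hiso : Nonempty (B ≃ₗ[Λ] Y)
  · obtain ⟨e⟩ := hiso
    have hinj := (hbrick.2.2 (e.symm.toLinearMap ∘ₗ (f : (B ⧸ N) →ₗ[Λ] Y) ∘ₗ N.mkQ) fun h0 =>
      hg <| by
        apply LinearMap.ext
        intro x
        simpa using LinearMap.congr_fun h0 x).1
    apply hN
    rw [eq_bot_iff]
    intro x hx
    have : N.mkQ x = 0 := by simpa using hx
    refine hinj ?_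
    rw [LinearMap.comp_apply, LinearMap.comp_apply, this, map_zero, map_zero, map_zero]
  · exact hg (hS.2.2 B hB Y hY (not_nonempty_iff.1 hiso) _)

theorem nonempty_equiv_of_mem_torsClosure (hS : IsSemibrick Λ S) (hB : B ∈ S) (hB' : B' ∈ S)
    (h : B' ∈ torsClosure Λ (insert B (lPerp Λ S))) : Nonempty (B ≃ₗ[Λ] B') := by
  by_contra hiso
  let F : Set (ModuleCat.{0} Λ) := {M ∈ S | IsEmpty (B ≃ₗ[Λ] M)}
  have hB'F : B' ∈ F := ⟨hB', not_nonempty_iff.1 hiso⟩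
  refine (hS.1 B' hB').notMem_lPerp hB'F (torsClosure_subset (isTorsionClass_lPerp F) ?_ h)
  rintro M (rfl | hM)
  · exact ⟨(hS.1 M hB).1, fun Y hY => hS.2.2 M hB Y hY.1 hY.2⟩
  · exact ⟨hM.1, fun Y hY => hM.2 Y hY.1⟩

theorem torsCovers_torsClosure_insert (hS : IsSemibrick Λ S) (hB : B ∈ S) :
    TorsCovers Λ (torsClosure Λ (insert B (lPerp Λ S))) (lPerp Λ S) := by
  have hsub := subset_torsClosure (insert B (lPerp Λ S))
  refine ⟨isTorsionClass_torsClosure ?_, ⟨fun M hM => hsub (Or.inr hM), fun h =>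
    (hS.isMinimalOutside hB).2.1 (h (hsub (Or.inl rfl)))⟩, fun U hU hlt hle => ?_⟩
  · rintro M (rfl | hM)
    exacts [(hS.1 M hB).1, hM.1]
  · obtain ⟨X, hXU, hX⟩ := Set.exists_of_ssubset hlt
    have : ∃ Y ∈ S, ∃ f : X →ₗ[Λ] Y, f ≠ 0 := by
      by_contra! h
      exact hX ⟨hU.1 X hXU, h⟩
    obtain ⟨Y, hY, f, hf⟩ := this
    have hYU := (hS.isMinimalOutside hY).mem_of_ne_zero hU hlt.1 hXU hf
    obtain ⟨e⟩ := hS.nonempty_equiv_of_mem_torsClosure hB hY (hle hYU)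
    exact hle.antisymm (torsClosure_subset hU
      (Set.insert_subset (hU.2.1 ⟨e.symm⟩ hYU) hlt.1))

theorem infinite_covers (hS : IsSemibrick Λ S) (hinf : ¬ FiniteUpToIso Λ S) :
    {T' | TorsCovers Λ T' (lPerp Λ S)}.Infinite := by
  intro hfin
  let τ : ModuleCat.{0} Λ → Set (ModuleCat.{0} Λ) := fun B =>
    torsClosure Λ (insert B (lPerp Λ S))
  have himg : (τ '' S).Finite :=
    hfin.subset (Set.image_subset_iff.2 fun B hB => hS.torsCovers_torsClosure_insert hB)
  obtain ⟨F, hFS, hF⟩ := Set.exists_subset_bijOn S τ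
  refine hinf ⟨F, hF.finite_iff_finite.2 himg, fun M hM => ?_⟩
  obtain ⟨N, hN, hNM⟩ := hF.surjOn (Set.mem_image_of_mem τ hM)
  exact ⟨N, hN, hS.nonempty_equiv_of_mem_torsClosure hM (hFS hN)
    (hNM.subset (subset_torsClosure (insert N (lPerp Λ S)) (Or.inl rfl)))⟩

end IsSemibrick

end Covers

/-- There is an infinite semibrick in `mod Λ` iff some torsion class has
infinitely many (pairwise distinct) covers in the poset of torsion classes. -/
theorem exists_infinite_semibrick_iff_infinitely_many_covers
    (K Λ : Type) [Field K] [Ring Λ] [Algebra K Λ] [FiniteDimensional K Λ] :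
    (∃ S, IsSemibrick Λ S ∧ ¬ FiniteUpToIso Λ S) ↔
      (∃ T, IsTorsionClass Λ T ∧ {T' | TorsCovers Λ T' T}.Infinite) := by
  have : IsArtinianRing Λ := .of_finite K Λ
  constructor
  · rintro ⟨S, hS, hinf⟩
    exact ⟨lPerp Λ S, isTorsionClass_lPerp S, hS.infinite_covers hinf⟩
  · rintro ⟨T, hT, hinf⟩
    exact exists_infinite_semibrick_of_infinite_covers hT hinf

end BrickPaper
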